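/- For a finite MDP with optimal value function V*, let L : S → ℝ satisfy L(s) > 0 for all s. Then for any V : S → ℝ and every state s ∈ S, (TV)(s) ≤ V(s) + (γ(HL)(s) + L(s)) · ‖V − V*‖_{∞,1/L}. -/

import Mathlib

open Finset

section Defs

variable {S A : Type*} [Fintype S] [Nonempty S] [Fintype A] [Nonempty A]

/-- The Bellman operator: `(T V)(s) = max_a [R(s) + γ ∑_{s'} P(s'|s,a) V(s')]`. -/
noncomputable def bellman (P : S → A → S → ℝ) (R : S → ℝ) (γ : ℝ) (V : S → ℝ) (s : S) : ℝ :=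
  univ.sup' univ_nonempty fun a => R s + γ * ∑ s', P s a s' * V s'

/-- The operator `H`: `(H L)(s) = max_a ∑_{s'} P(s'|s,a) L(s')`. -/
noncomputable def Hop (P : S → A → S → ℝ) (L : S → ℝ) (s : S) : ℝ :=
  univ.sup' univ_nonempty fun a => ∑ s', P s a s' * L s'

/-- `(Φ w)(s) = ∑ i, Φ_i(s) w_i`. -/
def phiW {k : ℕ} (Φ : S → Fin (k + 1) → ℝ) (w : Fin (k + 1) → ℝ) (s : S) : ℝ :=
  ∑ i, Φ s i * w i

/-- `‖w‖_{-1}`: the ℓ¹ norm of `w` with the bias coordinate (index 0) excluded. -/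
def normNeg1 {k : ℕ} (w : Fin (k + 1) → ℝ) : ℝ :=
  ∑ i ∈ Finset.univ.erase 0, |w i|

/-- The weighted max-norm `‖U‖_{∞,1/L} = max_s |U(s)| / L(s)`. -/
noncomputable def wmaxNorm (L U : S → ℝ) : ℝ :=
  univ.sup' univ_nonempty fun s => |U s| / L s

/-- The weighted L¹ norm `‖U‖_{1,ρ} = ∑_s ρ(s) |U(s)|`. -/
def w1Norm (ρ U : S → ℝ) : ℝ := ∑ s, ρ s * |U s|

/-- The max-absolute-value norm on functions `S → ℝ`. -/
noncomputable def maxNorm (U : S → ℝ) : ℝ :=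
  univ.sup' univ_nonempty fun s => |U s|

/-- RALP feasibility: `‖w‖_{-1} ≤ ψ` and all Bellman (state-action) constraints hold. -/
def RALPfeasible {k : ℕ} (P : S → A → S → ℝ) (R : S → ℝ) (γ : ℝ)
    (Φ : S → Fin (k + 1) → ℝ) (ψ : ℝ) (w : Fin (k + 1) → ℝ) : Prop :=
  normNeg1 w ≤ ψ ∧
    ∀ s a, R s + γ * ∑ s', P s a s' * phiW Φ w s' ≤ phiW Φ w s

/-- A RALP solution: a feasible `w` minimizing `∑ s, ρ s * (Φ w)(s)` over feasible vectors. -/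
def RALPsolution {k : ℕ} (P : S → A → S → ℝ) (R : S → ℝ) (γ : ℝ)
    (Φ : S → Fin (k + 1) → ℝ) (ψ : ℝ) (ρ : S → ℝ) (w : Fin (k + 1) → ℝ) : Prop :=
  RALPfeasible P R γ Φ ψ w ∧
    ∀ w', RALPfeasible P R γ Φ ψ w' →
      ∑ s, ρ s * phiW Φ w s ≤ ∑ s, ρ s * phiW Φ w' s

end Defs

theorem abs_le_mul_wmaxNorm {S : Type*} [Fintype S] [Nonempty S] {L : S → ℝ}
    (hL : ∀ s, 0 < L s) (U : S → ℝ) (s : S) : |U s| ≤ L s * wmaxNorm L U :=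
  (div_le_iff₀' (hL s)).1 (Finset.le_sup' (fun s => |U s| / L s) (Finset.mem_univ s))

theorem wmaxNorm_nonneg {S : Type*} [Fintype S] [Nonempty S] {L : S → ℝ}
    (hL : ∀ s, 0 < L s) (U : S → ℝ) : 0 ≤ wmaxNorm L U :=
  let s := Classical.arbitrary S
  nonneg_of_mul_nonneg_right ((abs_nonneg _).trans (abs_le_mul_wmaxNorm hL U s)) (hL s)

/-- `TV(s) ≤ V(s) + (γ(HL)(s) + L(s)) ‖V − V*‖_{∞,1/L}`. -/
theorem statement_6 {S A : Type*} [Fintype S] [Nonempty S] [Fintype A] [Nonempty A]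
    (P : S → A → S → ℝ) (R : S → ℝ) (γ : ℝ) (hγ0 : 0 ≤ γ) (hγ1 : γ < 1)
    (hP0 : ∀ s a s', 0 ≤ P s a s') (hP1 : ∀ s a, ∑ s', P s a s' = 1)
    (Vstar : S → ℝ) (hVstar : ∀ s, bellman P R γ Vstar s = Vstar s)
    (L : S → ℝ) (hL : ∀ s, 0 < L s)
    (V : S → ℝ) (s : S) :
    bellman P R γ V s ≤
      V s + (γ * Hop P L s + L s) * wmaxNorm L (fun x => V x - Vstar x) := by
  set N := wmaxNorm L (fun x => V x - Vstar x)
  have hN : 0 ≤ N := wmaxNorm_nonneg hL _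
  have hdiff (x : S) : |V x - Vstar x| ≤ L x * N :=
    abs_le_mul_wmaxNorm hL (fun x => V x - Vstar x) x
  refine Finset.sup'_le _ _ fun a _ => ?_
  have hstar : R s + γ * ∑ s', P s a s' * Vstar s' ≤ Vstar s :=
    (Finset.le_sup' (fun a => R s + γ * ∑ s', P s a s' * Vstar s')
      (Finset.mem_univ a)).trans_eq (hVstar s)
  have hH : ∑ s', P s a s' * L s' ≤ Hop P L s :=
    Finset.le_sup' (fun a => ∑ s', P s a s' * L s') (Finset.mem_univ a)
  have hsum : ∑ s', P s a s' * V s' ≤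
      ∑ s', P s a s' * Vstar s' + (∑ s', P s a s' * L s') * N := by
    rw [Finset.sum_mul, ← Finset.sum_add_distrib]
    refine Finset.sum_le_sum fun s' _ => ?_
    rw [mul_assoc, ← mul_add]
    exact mul_le_mul_of_nonneg_left (by linarith [(abs_le.1 (hdiff s')).2]) (hP0 s a s')
  have hstep := mul_le_mul_of_nonneg_left
    (hsum.trans (add_le_add_right (mul_le_mul_of_nonneg_right hH hN) _)) hγ0
  linarith [(abs_le.1 (hdiff s)).1]
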